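/- arXiv:1407.0498 — 2 statements merged into one kernel-verified Lean document; each statement's English description precedes it below -/
import Mathlib

section
/- In the scalar example problem, the process (b*,u*) = (0, u ≡ 0) is uniformly overtaking optimal; equivalently, since the trajectory from b* = 0 with u* ≡ 0 is x* ≡ 0 and has zero cost, liminf_{T→∞} inf{ ∫₀ᵀ e^{−2t}·x(t)·(x(t)⁴ − 5) dt : b ∈ [−1,2], u measurable with values in [0,1], x the solution of ẋ = f(x) + u with x(0) = b } ≥ 0. -/
open MeasureTheory Filter Topology

noncomputable section

/-- The piecewise dynamics of the example: `f(x) = 0` for `x < 0`,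
`x²/2` for `0 ≤ x ≤ 1`, `x − 1/2` for `x > 1`. -/
def fEx (x : ℝ) : ℝ := if x < 0 then 0 else if x ≤ 1 then x ^ 2 / 2 else x - 1 / 2

lemma fEx_nonneg (x : ℝ) : 0 ≤ fEx x := by
  unfold fEx
  split_ifs
  · exact le_rfl
  · positivity
  · linarith

lemma fEx_monotone : Monotone fEx := by
  intro x y hxy
  unfold fEx
  split_ifs <;> nlinarith

lemma fEx_le_abs (x : ℝ) : fEx x ≤ |x| := by
  unfold fEx
  split_ifs
  · positivity
  · nlinarith [le_abs_self x]
  · linarith [le_abs_self x]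

/-- Increments of a primitive between two points up to which the integrand is integrable. -/
lemma primitive_eq_add {g x : ℝ → ℝ} {b : ℝ} (hx : ∀ t, x t = b + ∫ s in (0:ℝ)..t, g s)
    {s t : ℝ} (hs : IntervalIntegrable g volume 0 s) (ht : IntervalIntegrable g volume 0 t) :
    x t = x s + ∫ r in s..t, g r := by
  rw [hx t, hx s, ← intervalIntegral.integral_add_adjacent_intervals hs (hs.symm.trans ht)]
  ring

lemma primitive_ge_add {g x : ℝ → ℝ} {b : ℝ} (hx : ∀ t, x t = b + ∫ s in (0:ℝ)..t, g s)
    {s t m : ℝ} (hst : s ≤ t) (hs : IntervalIntegrable g volume 0 s)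
    (ht : IntervalIntegrable g volume 0 t) (hm : ∀ r ∈ Set.Icc s t, m ≤ g r) :
    x s + (t - s) * m ≤ x t := by
  have h := intervalIntegral.integral_mono_on hst (intervalIntegrable_const (c := m))
    (hs.symm.trans ht) hm
  rw [intervalIntegral.integral_const, smul_eq_mul] at h
  linarith [primitive_eq_add hx hs ht]

lemma primitive_le_add {g x : ℝ → ℝ} {b : ℝ} (hx : ∀ t, x t = b + ∫ s in (0:ℝ)..t, g s)
    {s t m : ℝ} (hst : s ≤ t) (hs : IntervalIntegrable g volume 0 s)
    (ht : IntervalIntegrable g volume 0 t) (hm : ∀ r ∈ Set.Icc s t, g r ≤ m) :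
    x t ≤ x s + (t - s) * m := by
  have h := intervalIntegral.integral_mono_on hst (hs.symm.trans ht)
    (intervalIntegrable_const (c := m)) hm
  rw [intervalIntegral.integral_const, smul_eq_mul] at h
  linarith [primitive_eq_add hx hs ht]

/-- A primitive of a nonnegative function is measurable on the nonnegative half-line, even
when the function fails to be integrable from some time on. -/
lemma primitive_aemeasurable {g x : ℝ → ℝ} {b : ℝ} (hg : ∀ t, 0 ≤ g t)
    (hx : ∀ t, x t = b + ∫ s in (0:ℝ)..t, g s) :
    AEMeasurable x (volume.restrict (Set.Ici 0)) := by
  set S : Set ℝ := {t | 0 ≤ t ∧ IntervalIntegrable g volume 0 t} with hS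
  have hmono : ∀ s t, 0 ≤ s → s ≤ t → IntervalIntegrable g volume 0 t →
      IntervalIntegrable g volume 0 s := fun s t h0 hst ht =>
    ht.mono_set (by
      rw [Set.uIcc_of_le h0, Set.uIcc_of_le (h0.trans hst)]
      exact Set.Icc_subset_Icc_right hst)
  have hSo : S.OrdConnected := ⟨fun p hp q hq r hr =>
    ⟨hp.1.trans hr.1, hmono r q (hp.1.trans hr.1) hr.2 hq.2⟩⟩
  have hSm : MeasurableSet S := hSo.measurableSet
  have hxS : MonotoneOn x S := fun p hp q hq hpq => by
    have := primitive_ge_add hx hpq hp.2 hq.2 (m := 0) fun r _ => hg r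
    linarith
  have hcover : Set.Ici (0:ℝ) = S ∪ (Set.Ici 0 \ S) := by
    rw [Set.union_sdiff_cancel]
    exact fun t ht => ht.1
  rw [hcover, aemeasurable_union_iff]
  refine ⟨aemeasurable_restrict_of_monotoneOn hSm hxS, ?_⟩
  refine (aemeasurable_const (b := b)).congr ?_
  refine (ae_restrict_iff' (measurableSet_Ici.diff hSm)).2 (Eventually.of_forall fun t ht => ?_)
  have : ¬ IntervalIntegrable g volume 0 t := fun h => ht.2 ⟨ht.1, h⟩
  rw [hx t, intervalIntegral.integral_undef this, add_zero]

/-- Along a solution of the integral equation, the right-hand side is integrable, so the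
equation is never satisfied by a junk value of the integral. -/
lemma rhs_intervalIntegrable {b : ℝ} {u x : ℝ → ℝ} (hum : Measurable u)
    (hu : ∀ t : ℝ, u t ∈ Set.Icc (0:ℝ) 1)
    (hx : ∀ t : ℝ, x t = b + ∫ s in (0:ℝ)..t, (fEx (x s) + u s)) {t : ℝ} (ht : 0 ≤ t) :
    IntervalIntegrable (fun s => fEx (x s) + u s) volume 0 t := by
  set g : ℝ → ℝ := fun s => fEx (x s) + u s with hgdef
  have hg : ∀ t, 0 ≤ g t := fun t => add_nonneg (fEx_nonneg _) (hu t).1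
  have hb : ∀ s, 0 ≤ s → b ≤ x s := fun s hs => by
    rw [hx s]
    linarith [intervalIntegral.integral_nonneg (μ := volume) hs fun r _ => hg r]
  have hgm : AEMeasurable g (volume.restrict (Set.Ici 0)) :=
    (fEx_monotone.measurable.comp_aemeasurable (primitive_aemeasurable hg hx)).add
      hum.aemeasurable
  have hmono : ∀ s t, 0 ≤ s → s ≤ t → IntervalIntegrable g volume 0 t →
      IntervalIntegrable g volume 0 s := fun s t h0 hst ht =>
    ht.mono_set (by
      rw [Set.uIcc_of_le h0, Set.uIcc_of_le (h0.trans hst)]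
      exact Set.Icc_subset_Icc_right hst)
  have step : ∀ s, 0 ≤ s → IntervalIntegrable g volume 0 s →
      IntervalIntegrable g volume 0 (s + 1 / 2) := by
    intro s hs hgs
    have hbound : ∀ r ∈ Set.Ioc 0 (s + 1 / 2), x r ≤ 2 * |x s| + |b| + 1 := by
      intro r hr
      by_cases hgr : IntervalIntegrable g volume 0 r
      · rcases le_total r s with hrs | hsr
        · have := primitive_ge_add hx hrs hgr hgs (m := 0) fun q _ => hg q
          linarith [le_abs_self (x s), abs_nonneg (x s), abs_nonneg b]
        · have h1 := primitive_le_add hx hsr hgs hgr (m := |x r| + 1) fun q hq => by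
            have h0 : 0 ≤ q := hs.trans hq.1
            have hqr : x q ≤ x r := by
              have := primitive_ge_add hx hq.2 (hmono q r h0 hq.2 hgr) hgr (m := 0)
                fun p _ => hg p
              linarith
            exact add_le_add ((fEx_monotone hqr).trans (fEx_le_abs _)) (hu q).2
          have h2 : (r - s) * (|x r| + 1) ≤ 1 / 2 * (|x r| + 1) :=
            mul_le_mul_of_nonneg_right (by linarith [hr.2]) (by positivity)
          have h3 := le_abs_self (x s)
          rcases abs_cases (x r) with h | h <;> linarith [abs_nonneg b, abs_nonneg (x s)]
      · have : x r = b := by rw [hx r, intervalIntegral.integral_undef hgr, add_zero]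
        linarith [le_abs_self b, abs_nonneg (x s)]
    rw [intervalIntegrable_iff_integrableOn_Ioc_of_le (by linarith)]
    have hgI : AEMeasurable g (volume.restrict (Set.Ioc 0 (s + 1 / 2))) :=
      hgm.mono_measure (Measure.restrict_mono (fun r hr => hr.1.le) le_rfl)
    refine IntegrableOn.of_bound (C := fEx (2 * |x s| + |b| + 1) + 1)
      (by simp) hgI.aestronglyMeasurable ?_
    refine (ae_restrict_iff' measurableSet_Ioc).2 (Eventually.of_forall fun r hr => ?_)
    rw [Real.norm_of_nonneg (hg r)]
    exact add_le_add (fEx_monotone (hbound r hr)) (hu r).2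
  have hnat : ∀ n : ℕ, IntervalIntegrable g volume 0 ((n : ℝ) / 2) := by
    intro n
    induction n with
    | zero => simp
    | succ n ih =>
      have := step _ (by positivity) ih
      convert this using 1
      push_cast
      ring
  obtain ⟨n, hn⟩ := exists_nat_ge (2 * t)
  exact hmono t _ ht (by linarith) (hnat n)

/-- The state grows at least by `f` evaluated at the initial value of a time interval. -/
lemma solution_ge_add {b : ℝ} {u x : ℝ → ℝ} (hum : Measurable u)
    (hu : ∀ t : ℝ, u t ∈ Set.Icc (0:ℝ) 1)
    (hx : ∀ t : ℝ, x t = b + ∫ s in (0:ℝ)..t, (fEx (x s) + u s)) {s t : ℝ}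
    (hs : 0 ≤ s) (hst : s ≤ t) : x s + (t - s) * fEx (x s) ≤ x t := by
  have hI : ∀ r, 0 ≤ r → IntervalIntegrable (fun s => fEx (x s) + u s) volume 0 r :=
    fun r hr => rhs_intervalIntegrable hum hu hx hr
  refine primitive_ge_add hx hst (hI s hs) (hI t (hs.trans hst)) fun r hr => ?_
  have hsr : x s ≤ x r := by
    have := primitive_ge_add hx hr.1 (hI s hs) (hI r (hs.trans hr.1)) (m := 0)
      fun q _ => add_nonneg (fEx_nonneg _) (hu q).1
    linarith
  linarith [fEx_monotone hsr, (hu r).1]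

lemma neg_four_le_cost {x : ℝ} (hx : -1 ≤ x) : -4 ≤ x * (x ^ 4 - 5) := by
  have h2 : x * (x ^ 4 - 5) + 4 = (x - 1) ^ 2 * (x ^ 3 + 2 * x ^ 2 + 3 * x + 4) := by ring
  have h3 : 0 ≤ x ^ 3 + 2 * x ^ 2 + 3 * x + 4 := by
    nlinarith [mul_nonneg (by linarith : (0:ℝ) ≤ x + 1) (sq_nonneg x), sq_nonneg (x + 1)]
  nlinarith [mul_nonneg (sq_nonneg (x - 1)) h3]

lemma cube_sub_six_le_cost {x : ℝ} (hx : 0 ≤ x) : x ^ 3 - 6 ≤ x * (x ^ 4 - 5) := by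
  nlinarith [mul_nonneg hx (sq_nonneg (x ^ 2 - 3 / 2 + 1 / 8)), sq_nonneg (x - 1),
    mul_nonneg hx (sq_nonneg (x - 1)), mul_nonneg hx (sq_nonneg (x - 11 / 10)),
    sq_nonneg (x - 11 / 10)]

lemma neg_five_mul_le_cost {x δ : ℝ} (hx : -1 ≤ x) (hδ : 0 ≤ δ) (hxδ : x ≤ δ) :
    -(5 * δ) ≤ x * (x ^ 4 - 5) := by
  rcases le_total 0 x with h | h
  · nlinarith [mul_nonneg h (by positivity : 0 ≤ x ^ 4)]
  · have h1 : x ^ 2 ≤ 1 := by nlinarith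
    have h2 : x ^ 4 ≤ 5 := by nlinarith
    nlinarith [mul_nonneg_of_nonpos_of_nonpos h (by linarith : x ^ 4 - 5 ≤ 0)]

/-- A solution above `1` at time `r` has its cube growing at least like `exp (2 (t - r))`. -/
lemma exp_le_solution_cube {x : ℝ → ℝ} {r : ℝ} (hr : 0 ≤ r)
    (hinc : ∀ s t, 0 ≤ s → s ≤ t → x s + (t - s) * fEx (x s) ≤ x t) (h1 : 1 < x r)
    {t : ℝ} (ht : r ≤ t) : Real.exp (2 * (t - r)) / 64 ≤ (x t) ^ 3 := by
  have hdouble : ∀ n : ℕ, 1 / 2 + 2 ^ n / 2 ≤ x (r + n) := by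
    intro n
    induction n with
    | zero => norm_num; exact h1.le
    | succ n ih =>
      have h := hinc (r + n) (r + (n + 1 : ℕ)) (by positivity) (by push_cast; linarith)
      have hpow : (1:ℝ) ≤ 2 ^ n := one_le_pow₀ (by norm_num)
      have hf : x (r + n) - 1 / 2 ≤ fEx (x (r + n)) := by
        unfold fEx
        split_ifs <;> nlinarith [sq_nonneg (x (r + n) - 1)]
      push_cast at h ⊢
      rw [pow_succ]
      have : r + ((n:ℝ) + 1) - (r + n) = 1 := by ring
      rw [this] at h
      linarith
  set n := ⌊t - r⌋₊ with hn
  have hn1 : (n:ℝ) ≤ t - r := Nat.floor_le (by linarith)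
  have hn2 : t - r < n + 1 := Nat.lt_floor_add_one _
  have hxt : (2:ℝ) ^ n / 2 ≤ x t := by
    have h := hinc (r + n) t (by positivity) (by linarith)
    have h2 := mul_nonneg (by linarith : 0 ≤ t - (r + n)) (fEx_nonneg (x (r + n)))
    linarith [hdouble n]
  have he : Real.exp 2 ≤ 8 := by
    have : Real.exp 2 = Real.exp 1 ^ 2 := by rw [← Real.exp_nat_mul]; norm_num
    rw [this]
    nlinarith [Real.exp_one_lt_d9, Real.exp_pos 1]
  calc Real.exp (2 * (t - r)) / 64 ≤ Real.exp ((n + 1 : ℕ) * 2) / 64 := by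
        have : 2 * (t - r) ≤ (n + 1 : ℕ) * 2 := by
          push_cast
          linarith
        gcongr
    _ = Real.exp 2 ^ (n + 1) / 64 := by rw [Real.exp_nat_mul]
    _ ≤ 8 ^ (n + 1) / 64 := by gcongr
    _ = ((2:ℝ) ^ n / 2) ^ 3 := by
        rw [div_pow, ← pow_mul, mul_comm n 3, pow_mul]
        norm_num [pow_succ]
        ring
    _ ≤ (x t) ^ 3 := by gcongr

lemma integral_exp_neg_mul_le {k T : ℝ} (hk : 0 < k) :
    ∫ t in (0:ℝ)..T, Real.exp (-k * t) ≤ 1 / k := by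
  rw [intervalIntegral.integral_comp_mul_left (fun t => Real.exp t) (neg_ne_zero.2 hk.ne'),
    integral_exp, mul_zero, Real.exp_zero, smul_eq_mul, inv_mul_eq_div, ← neg_div_neg_eq, neg_neg]
  gcongr
  linarith [Real.exp_pos (-k * T)]

/-- Conjecture 1 / optimality in the example. In the problem
"minimize `∫₀^∞ e^{−2t}·x·(x⁴−5) dt` subject to `ẋ = f(x)+u`, `u ∈ [0,1]`,
`x(0) ∈ [−1,2]`", the process `(0, u ≡ 0)` (with trajectory `x* ≡ 0` and zero
cost) is uniformly overtaking optimal: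
`liminf_{T→∞} inf_{(b,u)} ∫₀ᵀ e^{−2t}·x(t)·(x(t)⁴−5) dt ≥ 0`. -/
theorem stmt16 :
    ∀ ε > (0:ℝ), ∃ T₀ : ℝ, ∀ T ≥ T₀,
    ∀ b ∈ Set.Icc (-1:ℝ) 2, ∀ u : ℝ → ℝ, Measurable u →
    (∀ t : ℝ, u t ∈ Set.Icc (0:ℝ) 1) →
    ∀ x : ℝ → ℝ, (∀ t : ℝ, x t = b + ∫ s in (0:ℝ)..t, (fEx (x s) + u s)) →
    -ε ≤ ∫ t in (0:ℝ)..T, Real.exp (-2 * t) * (x t * ((x t) ^ 4 - 5)) := by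
  intro ε hε
  set c : ℝ := 50 / ε ^ 2 + 8 / ε with hc
  have hc0 : 0 < c := by positivity
  refine ⟨192 * Real.exp (4 * c), fun T hT b hb u hum hu x hx => ?_⟩
  have hT0 : 0 ≤ T := le_trans (by positivity) hT
  have hinc : ∀ s t, 0 ≤ s → s ≤ t → x s + (t - s) * fEx (x s) ≤ x t :=
    fun s t hs hst => solution_ge_add hum hu hx hs hst
  have hmono : ∀ s t, 0 ≤ s → s ≤ t → x s ≤ x t := fun s t hs hst => by
    linarith [hinc s t hs hst, mul_nonneg (sub_nonneg.2 hst) (fEx_nonneg (x s))]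
  have hge : ∀ t, 0 ≤ t → -1 ≤ x t := fun t ht => by
    have h0 : x 0 = b := by rw [hx 0, intervalIntegral.integral_same, add_zero]
    linarith [hmono 0 t le_rfl ht, hb.1]
  by_cases hint : IntervalIntegrable
      (fun t => Real.exp (-2 * t) * (x t * ((x t) ^ 4 - 5))) volume 0 T
  swap
  · rw [intervalIntegral.integral_undef hint]
    linarith
  have hE : ∀ k : ℝ, IntervalIntegrable (fun t => Real.exp (k * t)) volume 0 T :=
    fun k => (by fun_prop : Continuous fun t : ℝ => Real.exp (k * t)).intervalIntegrable _ _
  have hI2 := integral_exp_neg_mul_le (T := T) (k := 2) two_pos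
  rcases le_or_gt (x (2 * c)) 1 with hA | hB
  · have hxc : x c ≤ ε / 5 := by
      by_contra! hlt
      have h := hinc c (2 * c) hc0.le (by linarith)
      have hxc1 : x c ≤ 1 := (hmono c (2 * c) hc0.le (by linarith)).trans hA
      have hxc0 : 0 < x c := lt_trans (by positivity) hlt
      have hf : fEx (x c) = x c ^ 2 / 2 := by
        rw [fEx, if_neg hxc0.not_gt, if_pos hxc1]
      rw [hf] at h
      have h2 : (ε / 5) ^ 2 ≤ x c ^ 2 := by gcongr
      have h3 : 50 / ε ^ 2 ≤ c := by rw [hc]; linarith [(by positivity : 0 < 8 / ε)]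
      have h4 : 1 ≤ (2 * c - c) * (x c ^ 2 / 2) := by
        calc (1:ℝ) = 50 / ε ^ 2 * ((ε / 5) ^ 2 / 2) := by field_simp; norm_num
          _ ≤ c * (x c ^ 2 / 2) := by gcongr
          _ = _ := by ring
      linarith
    have hφ : ∀ t ∈ Set.Icc 0 T, -ε * Real.exp (-2 * t) + -(4 * Real.exp (-c)) * Real.exp (-1 * t)
        ≤ Real.exp (-2 * t) * (x t * ((x t) ^ 4 - 5)) := by
      intro t ht
      have hp := Real.exp_pos (-2 * t)
      rcases le_total t c with htc | hct
      · have h := neg_five_mul_le_cost (hge t ht.1) (by positivity)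
          ((hmono t c ht.1 htc).trans hxc)
        have := mul_pos (Real.exp_pos (-c)) (Real.exp_pos (-1 * t))
        nlinarith
      · have h := neg_four_le_cost (hge t ht.1)
        have h2 : Real.exp (-2 * t) ≤ Real.exp (-c) * Real.exp (-1 * t) := by
          rw [← Real.exp_add]
          exact Real.exp_le_exp.2 (by linarith)
        nlinarith
    have h := intervalIntegral.integral_mono_on hT0
      (((hE (-2)).const_mul _).add ((hE (-1)).const_mul _)) hint hφ
    rw [intervalIntegral.integral_add ((hE (-2)).const_mul _) ((hE (-1)).const_mul _),
      intervalIntegral.integral_const_mul, intervalIntegral.integral_const_mul] at h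
    have hI1 := integral_exp_neg_mul_le (T := T) (k := 1) one_pos
    have hexp : 4 * Real.exp (-c) ≤ ε / 2 := by
      have h1 : c ≤ Real.exp c := by linarith [Real.add_one_le_exp c]
      have h2 : 8 / ε ≤ c := by rw [hc]; linarith [(by positivity : 0 < 50 / ε ^ 2)]
      have h3 : 8 ≤ Real.exp c * ε := (div_le_iff₀ hε).1 (h2.trans h1)
      rw [Real.exp_neg, ← div_eq_mul_inv, div_le_iff₀ (Real.exp_pos c)]
      linarith
    have hm1 := mul_le_mul_of_nonneg_left hI2 hε.le
    have hm2 := mul_le_mul_of_nonneg_left hI1 (by positivity : 0 ≤ 4 * Real.exp (-c))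
    linarith
  · have hφ : ∀ t ∈ Set.Icc 0 T, Real.exp (-(4 * c)) / 64 + -6 * Real.exp (-2 * t)
        ≤ Real.exp (-2 * t) * (x t * ((x t) ^ 4 - 5)) := by
      intro t ht
      have hp := Real.exp_pos (-2 * t)
      rcases le_total t (2 * c) with htc | hct
      · have h := neg_four_le_cost (hge t ht.1)
        have h2 : Real.exp (-(4 * c)) ≤ Real.exp (-2 * t) :=
          Real.exp_le_exp.2 (by linarith)
        nlinarith
      · have h3 := exp_le_solution_cube (by positivity) hinc hB hct
        have h := cube_sub_six_le_cost (x := x t)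
          (by linarith [hmono (2 * c) t (by positivity) hct])
        have h4 : Real.exp (-2 * t) * Real.exp (2 * (t - 2 * c)) = Real.exp (-(4 * c)) := by
          rw [← Real.exp_add]
          ring_nf
        nlinarith
    have h := intervalIntegral.integral_mono_on hT0
      (intervalIntegrable_const.add ((hE (-2)).const_mul _)) hint hφ
    rw [intervalIntegral.integral_add intervalIntegrable_const ((hE (-2)).const_mul _),
      intervalIntegral.integral_const_mul, intervalIntegral.integral_const, smul_eq_mul] at h
    have hk : 3 ≤ (T - 0) * (Real.exp (-(4 * c)) / 64) := by
      calc (3:ℝ) = 192 * Real.exp (4 * c) * (Real.exp (-(4 * c)) / 64) := by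
            rw [Real.exp_neg]; field_simp; norm_num
        _ ≤ (T - 0) * (Real.exp (-(4 * c)) / 64) := by rw [sub_zero]; gcongr
    linarith
end
end

section
/- For every θ ≥ 0: 5·∫₀^θ e^{−2s}·( 2/(θ+2−s) ) ds ≤ 7/(θ+2). Consequently, for g(z) = z(z⁴−5) and x(s) = 2/(θ+2−s), one has ∫₀^θ e^{−2s}·g(x(s)) ds ≥ −7/(θ+2). -/
open MeasureTheory Filter Topology

noncomputable section

/-- `g(z) = z(z⁴ − 5)`. -/
def gEx (z : ℝ) : ℝ := z * (z ^ 4 - 5)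

/-- The weighted integral of the linear majorant `s + 2` in closed form. -/
theorem integral_exp_neg_two_mul_add_two (θ : ℝ) :
    ∫ s in (0:ℝ)..θ, Real.exp (-2 * s) * (s + 2) =
      5 / 4 - Real.exp (-2 * θ) * (θ / 2 + 5 / 4) := by
  have hderiv : ∀ s ∈ Set.uIcc 0 θ, HasDerivAt
      (fun s : ℝ => -(Real.exp (-2 * s) * (s / 2 + 5 / 4))) (Real.exp (-2 * s) * (s + 2)) s := by
    intro s _
    have hexp : HasDerivAt (fun s : ℝ => Real.exp (-2 * s)) (Real.exp (-2 * s) * (-2 * 1)) s :=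
      ((hasDerivAt_id s).const_mul (-2)).exp
    have hlin : HasDerivAt (fun s : ℝ => s / 2 + 5 / 4) (1 / 2) s :=
      ((hasDerivAt_id s).div_const 2).add_const _
    exact (hexp.mul hlin).neg.congr_deriv (by ring)
  rw [intervalIntegral.integral_eq_sub_of_hasDerivAt hderiv
    (Continuous.intervalIntegrable (by fun_prop) _ _)]
  simp
  ring

theorem two_div_sub_le {θ s : ℝ} (hs : 0 ≤ s) (hsθ : s ≤ θ) :
    2 / (θ + 2 - s) ≤ (s + 2) / (θ + 2) := by
  rw [div_le_div_iff₀ (by linarith) (by linarith)]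
  nlinarith [mul_nonneg hs (sub_nonneg.2 hsθ)]

theorem neg_five_mul_le_gEx {z : ℝ} (hz : 0 ≤ z) : -5 * z ≤ gEx z := by
  have : 0 ≤ z ^ 5 := by positivity
  unfold gEx
  linarith [show z * (z ^ 4 - 5) = z ^ 5 - 5 * z by ring]

/-- For every `θ ≥ 0`,
`5·∫₀^θ e^{−2s}·(2/(θ+2−s)) ds ≤ 7/(θ+2)`, and consequently for
`x(s) = 2/(θ+2−s)` we have `∫₀^θ e^{−2s}·g(x(s)) ds ≥ −7/(θ+2)`. -/
theorem stmt19 (θ : ℝ) (hθ : 0 ≤ θ) :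
    5 * (∫ s in (0:ℝ)..θ, Real.exp (-2 * s) * (2 / (θ + 2 - s))) ≤ 7 / (θ + 2) ∧
    -7 / (θ + 2) ≤ ∫ s in (0:ℝ)..θ, Real.exp (-2 * s) * gEx (2 / (θ + 2 - s)) := by
  have hx : ContinuousOn (fun s : ℝ => 2 / (θ + 2 - s)) (Set.uIcc 0 θ) := by
    refine continuousOn_const.div (by fun_prop) fun s hs => ?_
    rw [Set.uIcc_of_le hθ] at hs
    linarith [hs.2]
  have hexp : ContinuousOn (fun s : ℝ => Real.exp (-2 * s)) (Set.uIcc 0 θ) := by fun_prop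
  have hint : IntervalIntegrable (fun s : ℝ => Real.exp (-2 * s) * (2 / (θ + 2 - s)))
      volume 0 θ := (hexp.mul hx).intervalIntegrable
  have hbound : 5 * (∫ s in (0:ℝ)..θ, Real.exp (-2 * s) * (2 / (θ + 2 - s))) ≤ 7 / (θ + 2) := by
    have hle : (∫ s in (0:ℝ)..θ, Real.exp (-2 * s) * (2 / (θ + 2 - s))) ≤
        ∫ s in (0:ℝ)..θ, Real.exp (-2 * s) * (s + 2) / (θ + 2) := by
      refine intervalIntegral.integral_mono_on hθ hint
        (Continuous.intervalIntegrable (by fun_prop) _ _) fun s hs => ?_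
      rw [mul_div_assoc]
      exact mul_le_mul_of_nonneg_left (two_div_sub_le hs.1 hs.2) (Real.exp_pos _).le
    rw [intervalIntegral.integral_div, integral_exp_neg_two_mul_add_two] at hle
    have htail : 0 ≤ Real.exp (-2 * θ) * (θ / 2 + 5 / 4) := by positivity
    calc _ ≤ 5 * ((5 / 4 - Real.exp (-2 * θ) * (θ / 2 + 5 / 4)) / (θ + 2)) := by gcongr
      _ = 5 * (5 / 4 - Real.exp (-2 * θ) * (θ / 2 + 5 / 4)) / (θ + 2) := by ring
      _ ≤ 7 / (θ + 2) := by
        gcongr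
        linarith
  refine ⟨hbound, ?_⟩
  have hg : Continuous gEx := by
    unfold gEx
    fun_prop
  calc -7 / (θ + 2)
      ≤ -5 * ∫ s in (0:ℝ)..θ, Real.exp (-2 * s) * (2 / (θ + 2 - s)) := by
        rw [neg_div]
        linarith
    _ = ∫ s in (0:ℝ)..θ, -5 * (Real.exp (-2 * s) * (2 / (θ + 2 - s))) :=
        (intervalIntegral.integral_const_mul _ _).symm
    _ ≤ _ := by
        refine intervalIntegral.integral_mono_on hθ (hint.const_mul _)
          (hexp.mul (hg.comp_continuousOn hx)).intervalIntegrable fun s hs => ?_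
        rw [mul_left_comm]
        have hpos : 0 ≤ 2 / (θ + 2 - s) := div_nonneg (by norm_num) (by linarith [hs.2])
        exact mul_le_mul_of_nonneg_left (neg_five_mul_le_gEx hpos) (Real.exp_pos _).le
end
end
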